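/- Let 0 ≤ k ≤ i and 0 ≤ ℓ. Suppose S̄₁, …, S̄_M are totally singular (i−k)-dimensional subspaces of 𝔽₂^i × 𝔽₂^i such that dim(S̄_r ∩ S̄_t) ≤ ℓ for all r ≠ t. For r, t ∈ {1, …, M} (possibly equal), let S_r, S_t be the preimages, let χ, χ' be group homomorphisms to {1, −1} sending −I to −1, and let Π = Π(S_r, χ), Π' = Π(S_t, χ'). If Π ≠ Π', then ½‖Π − Π'‖² ≥ 2^k − 2^{2k+ℓ−i}, where ‖·‖ is the Frobenius norm and the powers of 2 are taken in ℝ (the exponent 2k+ℓ−i may be negative). -/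

import Mathlib

open Matrix BigOperators

/-- `U i = 𝔽₂^i`. -/
abbrev U (i : ℕ) := Fin i → ZMod 2

/-- Standard inner product on `𝔽₂^i`. -/
def dotp {i : ℕ} (a b : U i) : ZMod 2 := ∑ j, a j * b j

/-- The matrix of the map `X(a) : e_u ↦ e_{u+a}`. -/
def XM {i : ℕ} (a : U i) : Matrix (U i) (U i) ℝ :=
  fun w u => if w = u + a then 1 else 0

/-- The matrix of the map `Y(b) : e_u ↦ (−1)^{b·u} e_u`. -/
def YM {i : ℕ} (b : U i) : Matrix (U i) (U i) ℝ :=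
  Matrix.diagonal (fun u => (-1 : ℝ) ^ (dotp b u).val)

/-- The averaged operator `Π(S, χ) = (1/|S|) Σ_{g∈S} χ(g)·g`. -/
noncomputable def PiMat {i : ℕ} (S : Subgroup (Matrix (U i) (U i) ℝ)ˣ)
    (χ : S →* ℝˣ) : Matrix (U i) (U i) ℝ :=
  (Nat.card S : ℝ)⁻¹ • ∑ᶠ g : S, (χ g : ℝ) • ((g : (Matrix (U i) (U i) ℝ)ˣ) : Matrix (U i) (U i) ℝ)

/-- A subspace of `𝔽₂^i × 𝔽₂^i` is totally singular for `Q(a,b) = a·b` if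
    `a·b = 0` for all its elements. -/
def TotSing {i : ℕ} (S : Submodule (ZMod 2) (U i × U i)) : Prop :=
  ∀ p ∈ S, dotp p.1 p.2 = 0

/-- The preimage in `E` of a subspace `S̄ ⊆ 𝔽₂^i × 𝔽₂^i`, i.e. the subgroup
    `{ε·X(a)Y(b) : ε = ±1, (a,b) ∈ S̄}`. -/
def preim {i : ℕ} (S : Submodule (ZMod 2) (U i × U i)) :
    Subgroup (Matrix (U i) (U i) ℝ)ˣ :=
  Subgroup.closure
    {g : (Matrix (U i) (U i) ℝ)ˣ |
      ∃ a b : U i, (a, b) ∈ S ∧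
        ((g : Matrix (U i) (U i) ℝ) = XM a * YM b ∨
         (g : Matrix (U i) (U i) ℝ) = -(XM a * YM b))}

/-- The squared Frobenius norm of a real matrix. -/
def frobSq {n : Type*} [Fintype n] (A : Matrix n n ℝ) : ℝ :=
  ∑ u, ∑ v, (A u v) ^ 2

/-- The sign `(-1)^x` of an element of `𝔽₂`. -/
def signZ (x : ZMod 2) : ℝ := (-1 : ℝ) ^ x.val

lemma signZ_zero : signZ 0 = 1 := by simp [signZ]

lemma signZ_add (x y : ZMod 2) : signZ (x + y) = signZ x * signZ y := by
  have h : ∀ x : ZMod 2, x = 0 ∨ x = 1 := by decide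
  rcases h x with rfl | rfl <;> rcases h y with rfl | rfl <;>
    simp [signZ, ZMod.val_one, show (1 : ZMod 2) + 1 = 0 from rfl]

lemma signZ_eq_one_or (x : ZMod 2) : signZ x = 1 ∨ signZ x = -1 :=
  neg_one_pow_eq_or ℝ x.val

lemma signZ_mul_self (x : ZMod 2) : signZ x * signZ x = 1 := by
  rcases signZ_eq_one_or x with h | h <;> simp [h]

lemma signZ_of_ne_zero {x : ZMod 2} (hx : x ≠ 0) : signZ x = -1 := by
  have h : ∀ x : ZMod 2, x ≠ 0 → x = 1 := by decide
  rw [h x hx]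
  simp [signZ, ZMod.val_one]

section

variable {i : ℕ}

lemma add_self_eq_zero_zmod_two {M : Type*} [AddCommGroup M] [Module (ZMod 2) M] (p : M) :
    p + p = 0 := by
  rw [← two_smul (ZMod 2) p, show (2 : ZMod 2) = 0 from rfl, zero_smul]

lemma dotp_add_left (a b c : U i) : dotp (a + b) c = dotp a c + dotp b c :=
  add_dotProduct a b c

lemma dotp_add_right (a b c : U i) : dotp a (b + c) = dotp a b + dotp a c :=
  dotProduct_add a b c

/-- The sum of a nontrivial sign character of `𝔽₂^i` vanishes. -/
lemma sum_signZ_dotp (b : U i) :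
    ∑ u, signZ (dotp b u) = if b = 0 then (2 : ℝ) ^ i else 0 := by
  split_ifs with hb
  · subst hb
    have h : ∀ u : U i, dotp 0 u = 0 := fun u => zero_dotProduct u
    simp [h, signZ_zero]
  · obtain ⟨j, hj⟩ := Function.ne_iff.1 hb
    obtain ⟨v, hv⟩ : ∃ v : U i, dotp b v = b j := ⟨Pi.single j 1, dotProduct_single_one b j⟩
    have h := Equiv.sum_comp (Equiv.addRight v) fun u => signZ (dotp b u)
    simp only [Equiv.coe_addRight, dotp_add_right, signZ_add, hv, signZ_of_ne_zero hj, mul_neg,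
      mul_one, Finset.sum_neg_distrib] at h
    linarith

/-- The matrix of `X(a)Y(b)`. -/
def XY (p : U i × U i) : Matrix (U i) (U i) ℝ := XM p.1 * YM p.2

lemma XY_apply (p : U i × U i) (w u : U i) :
    XY p w u = if w = u + p.1 then signZ (dotp p.2 u) else 0 := by
  simp [XY, YM, XM, Matrix.mul_diagonal, signZ]

lemma XY_zero : XY (0 : U i × U i) = 1 := by
  ext w u
  have h : dotp 0 u = 0 := zero_dotProduct u
  simp [XY_apply, Matrix.one_apply, h, signZ_zero]

lemma XY_mul (p q : U i × U i) : XY p * XY q = signZ (dotp p.2 q.1) • XY (p + q) := by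
  ext w u
  simp only [Matrix.mul_apply, XY_apply, Matrix.smul_apply, smul_eq_mul, mul_ite, mul_zero,
    Finset.sum_ite_eq', Finset.mem_univ, if_true, Prod.fst_add, Prod.snd_add,
    ite_mul, zero_mul, dotp_add_left, dotp_add_right, signZ_add]
  rw [show u + q.1 + p.1 = u + (p.1 + q.1) by abel]
  split_ifs <;> ring

/-- The matrices `X(a)Y(b)` are orthogonal for the Frobenius inner product. -/
lemma sum_XY_mul_XY (p q : U i × U i) :
    ∑ w, ∑ u, XY p w u * XY q w u = if p = q then (2 : ℝ) ^ i else 0 := by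
  rw [Finset.sum_comm]
  simp only [XY_apply, ite_mul, zero_mul, Finset.sum_ite_eq', Finset.mem_univ, if_true,
    add_right_inj, mul_ite, mul_zero]
  by_cases h1 : p.1 = q.1
  · have hz : p.2 + q.2 = 0 ↔ p = q := by
      rw [Prod.ext_iff, ← add_self_eq_zero_zmod_two q.2, add_left_inj]
      simp [h1]
    simp only [h1, if_true, ← signZ_add, ← dotp_add_left, sum_signZ_dotp, hz]
  · have : p ≠ q := fun h => h1 (h ▸ rfl)
    simp [this, Ne.symm h1]

/-- Parseval's identity for the orthogonal family `X(a)Y(b)`. -/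
lemma frobSq_sum_smul_XY (c : U i × U i → ℝ) :
    frobSq (∑ p, c p • XY p) = (2 : ℝ) ^ i * ∑ p, c p ^ 2 := by
  have h : ∀ w u, (∑ p, c p • XY p) w u ^ 2 = ∑ p, ∑ q, c p * c q * (XY p w u * XY q w u) := by
    intro w u
    simp only [Matrix.sum_apply, Matrix.smul_apply, smul_eq_mul, sq, Finset.sum_mul_sum]
    exact Finset.sum_congr rfl fun p _ => Finset.sum_congr rfl fun q _ => by ring
  calc frobSq (∑ p, c p • XY p)
      = ∑ w, ∑ u, ∑ p, ∑ q, c p * c q * (XY p w u * XY q w u) := by simp only [frobSq, h]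
    _ = ∑ p, ∑ q, c p * c q * ∑ w, ∑ u, XY p w u * XY q w u := by
        simp only [Finset.mul_sum]
        rw [Finset.sum_congr rfl fun w _ => Finset.sum_comm, Finset.sum_comm]
        refine Finset.sum_congr rfl fun p _ => ?_
        rw [Finset.sum_congr rfl fun w _ => Finset.sum_comm, Finset.sum_comm]
    _ = (2 : ℝ) ^ i * ∑ p, c p ^ 2 := by
        simp only [sum_XY_mul_XY, mul_ite, mul_zero, Finset.sum_ite_eq, Finset.mem_univ, if_true,
          Finset.mul_sum]
        exact Finset.sum_congr rfl fun p _ => by ring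

lemma frobSq_smul {n : Type*} [Fintype n] (a : ℝ) (A : Matrix n n ℝ) :
    frobSq (a • A) = a ^ 2 * frobSq A := by
  simp [frobSq, mul_pow, Finset.mul_sum]

lemma XY_injective : Function.Injective (XY : U i × U i → Matrix (U i) (U i) ℝ) := by
  intro p q h
  by_contra hpq
  have h1 := sum_XY_mul_XY p q
  have h2 := sum_XY_mul_XY p p
  rw [← h, h2] at h1
  simp [hpq] at h1

lemma XY_ne_neg (p q : U i × U i) : XY p ≠ -XY q := by
  intro h
  have h1 := sum_XY_mul_XY p q
  have h2 := sum_XY_mul_XY q q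
  rw [h] at h1
  simp only [Matrix.neg_apply, neg_mul, Finset.sum_neg_distrib, h2, if_true] at h1
  have : (0 : ℝ) < 2 ^ i := by positivity
  split_ifs at h1 <;> linarith

/-- `X(a)Y(b)` as an invertible matrix. -/
def unitXY (p : U i × U i) : (Matrix (U i) (U i) ℝ)ˣ where
  val := XY p
  inv := signZ (dotp p.2 p.1) • XY p
  val_inv := by
    rw [Matrix.mul_smul, XY_mul, smul_smul, signZ_mul_self, add_self_eq_zero_zmod_two, XY_zero,
      one_smul]
  inv_val := by
    rw [Matrix.smul_mul, XY_mul, smul_smul, signZ_mul_self, add_self_eq_zero_zmod_two, XY_zero,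
      one_smul]

lemma unitXY_zero : unitXY (0 : U i × U i) = 1 := Units.ext XY_zero

lemma unitXY_mul (p q : U i × U i) :
    unitXY p * unitXY q = unitXY (p + q) ∨ unitXY p * unitXY q = -unitXY (p + q) := by
  rcases signZ_eq_one_or (dotp p.2 q.1) with h | h
  · left
    ext1
    simp [unitXY, XY_mul, h]
  · right
    ext1
    simp [unitXY, XY_mul, h]

lemma unitXY_inv (p : U i × U i) : (unitXY p)⁻¹ = unitXY p ∨ (unitXY p)⁻¹ = -unitXY p := by
  rcases unitXY_mul p p with h | h <;>
    rw [add_self_eq_zero_zmod_two, unitXY_zero] at h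
  · exact Or.inl (inv_eq_of_mul_eq_one_right h)
  · exact Or.inr (inv_eq_of_mul_eq_one_right (by rw [mul_neg, h, neg_neg]))

variable {T : Submodule (ZMod 2) (U i × U i)}

lemma unitXY_mem_preim {p : U i × U i} (hp : p ∈ T) : unitXY p ∈ preim T :=
  Subgroup.subset_closure ⟨p.1, p.2, hp, Or.inl rfl⟩

lemma neg_unitXY_mem_preim {p : U i × U i} (hp : p ∈ T) : -unitXY p ∈ preim T :=
  Subgroup.subset_closure ⟨p.1, p.2, hp, Or.inr rfl⟩

lemma exists_of_mem_preim {g : (Matrix (U i) (U i) ℝ)ˣ} (hg : g ∈ preim T) :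
    ∃ p ∈ T, g = unitXY p ∨ g = -unitXY p := by
  induction hg using Subgroup.closure_induction with
  | mem g hg =>
    obtain ⟨a, b, hab, h | h⟩ := hg
    · exact ⟨(a, b), hab, Or.inl (Units.ext h)⟩
    · exact ⟨(a, b), hab, Or.inr (Units.ext h)⟩
  | one => exact ⟨0, T.zero_mem, Or.inl unitXY_zero.symm⟩
  | mul g h _ _ hg hh =>
    obtain ⟨p, hp, hg⟩ := hg
    obtain ⟨q, hq, hh⟩ := hh
    refine ⟨p + q, T.add_mem hp hq, ?_⟩
    rcases hg with rfl | rfl <;> rcases hh with rfl | rfl <;>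
      rcases unitXY_mul p q with h | h <;> simp [h]
  | inv g _ hg =>
    obtain ⟨p, hp, hg⟩ := hg
    refine ⟨p, hp, ?_⟩
    rcases hg with rfl | rfl <;> rcases unitXY_inv p with h | h <;> simp [inv_neg, h]

/-- The parametrization of the preimage of `T` by `T` and a sign. -/
def preimParam (T : Submodule (ZMod 2) (U i × U i)) (x : T × Bool) : preim T :=
  if x.2 then ⟨unitXY x.1, unitXY_mem_preim x.1.2⟩ else ⟨-unitXY x.1, neg_unitXY_mem_preim x.1.2⟩

lemma preimParam_bijective (T : Submodule (ZMod 2) (U i × U i)) :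
    Function.Bijective (preimParam T) := by
  constructor
  · rintro ⟨p, x⟩ ⟨q, y⟩ h
    have h' := congrArg (fun g : preim T => ((g : (Matrix (U i) (U i) ℝ)ˣ) : Matrix (U i) (U i) ℝ)) h
    cases x <;> cases y <;> simp [preimParam, unitXY] at h'
    · simpa using Subtype.ext (XY_injective h')
    · exact absurd h'.symm (XY_ne_neg _ _)
    · exact absurd h' (XY_ne_neg _ _)
    · simpa using Subtype.ext (XY_injective h')
  · rintro ⟨g, hg⟩
    obtain ⟨p, hp, rfl | rfl⟩ := exists_of_mem_preim hg
    · exact ⟨(⟨p, hp⟩, true), by simp [preimParam]⟩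
    · exact ⟨(⟨p, hp⟩, false), by simp [preimParam]⟩

open Classical in
/-- The coefficient of `X(a)Y(b)` in the (unnormalized) sum defining `PiMat`. -/
noncomputable def coeffXY (χ : preim T →* ℝˣ) (p : U i × U i) : ℝ :=
  if hp : p ∈ T then (χ ⟨unitXY p, unitXY_mem_preim hp⟩ : ℝ) else 0

lemma coeffXY_of_notMem (χ : preim T →* ℝˣ) {p : U i × U i} (hp : p ∉ T) : coeffXY χ p = 0 :=
  dif_neg hp

lemma coeffXY_of_mem (χ : preim T →* ℝˣ) {p : U i × U i} (hp : p ∈ T) :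
    coeffXY χ p = (χ ⟨unitXY p, unitXY_mem_preim hp⟩ : ℝ) :=
  dif_pos hp

lemma coeffXY_sq (χ : preim T →* ℝˣ) (hval : ∀ s : preim T, (χ s : ℝ) = 1 ∨ (χ s : ℝ) = -1)
    {p : U i × U i} (hp : p ∈ T) : coeffXY χ p ^ 2 = 1 := by
  rw [coeffXY_of_mem χ hp]
  rcases hval ⟨unitXY p, unitXY_mem_preim hp⟩ with h | h <;> simp [h]

lemma map_neg_unitXY (χ : preim T →* ℝˣ)
    (hχ : ∀ m : preim T, ((m : (Matrix (U i) (U i) ℝ)ˣ) : Matrix (U i) (U i) ℝ) = -1 → χ m = -1)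
    {p : U i × U i} (hp : p ∈ T) :
    (χ ⟨-unitXY p, neg_unitXY_mem_preim hp⟩ : ℝ) = -coeffXY χ p := by
  have hm : (-1 : (Matrix (U i) (U i) ℝ)ˣ) ∈ preim T := by
    simpa [unitXY_zero] using neg_unitXY_mem_preim (T.zero_mem)
  have h : (⟨-unitXY p, neg_unitXY_mem_preim hp⟩ : preim T) =
      ⟨-1, hm⟩ * ⟨unitXY p, unitXY_mem_preim hp⟩ := Subtype.ext (by simp)
  rw [h, map_mul, hχ ⟨-1, hm⟩ (by simp), coeffXY_of_mem χ hp]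
  simp

lemma PiMat_preim (χ : preim T →* ℝˣ)
    (hχ : ∀ m : preim T, ((m : (Matrix (U i) (U i) ℝ)ˣ) : Matrix (U i) (U i) ℝ) = -1 → χ m = -1) :
    PiMat (preim T) χ = (Nat.card T : ℝ)⁻¹ • ∑ p, coeffXY χ p • XY p := by
  classical
  have hcard : Nat.card (preim T) = Nat.card T * 2 := by
    rw [← Nat.card_eq_of_bijective _ (preimParam_bijective T), Nat.card_prod]
    simp
  have hsum : ∑ p, coeffXY χ p • XY p = ∑ p : T, coeffXY χ p • XY (p : U i × U i) := by
    refine (Finset.sum_subset (Finset.subset_univ (Finset.univ.filter (· ∈ T)))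
      fun p _ hp => ?_).symm.trans (Finset.sum_subtype _ (by simp) _)
    rw [coeffXY_of_notMem χ (by simpa using hp), zero_smul]
  rw [PiMat, hcard, hsum, ← finsum_eq_of_bijective _ (preimParam_bijective T) (fun _ => rfl),
    finsum_eq_sum_of_fintype, Fintype.sum_prod_type]
  have hterm : ∀ p : T, ∑ x : Bool, (χ (preimParam T (p, x)) : ℝ) •
      ((preimParam T (p, x) : (Matrix (U i) (U i) ℝ)ˣ) : Matrix (U i) (U i) ℝ) =
      (2 : ℝ) • coeffXY χ p • XY (p : U i × U i) := by
    intro p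
    have h := map_neg_unitXY χ hχ p.2
    simp only [Fintype.sum_bool, preimParam, if_true, Bool.false_eq_true, if_false, h,
      ← coeffXY_of_mem χ p.2, Units.val_neg]
    simp [unitXY, two_smul]
  rw [Finset.sum_congr rfl fun p _ => hterm p, ← Finset.smul_sum, smul_smul]
  congr 1
  push_cast
  rw [mul_inv, mul_assoc, inv_mul_cancel₀ two_ne_zero, mul_one]

/-- The products of the coefficients of two characters of the same preimage are multiplicative. -/
lemma coeffXY_mul_coeffXY_add (χ χ' : preim T →* ℝˣ)
    (hχ : ∀ m : preim T, ((m : (Matrix (U i) (U i) ℝ)ˣ) : Matrix (U i) (U i) ℝ) = -1 → χ m = -1)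
    (hχ' : ∀ m : preim T, ((m : (Matrix (U i) (U i) ℝ)ˣ) : Matrix (U i) (U i) ℝ) = -1 → χ' m = -1)
    {p q : U i × U i} (hp : p ∈ T) (hq : q ∈ T) :
    coeffXY χ (p + q) * coeffXY χ' (p + q) =
      (coeffXY χ p * coeffXY χ' p) * (coeffXY χ q * coeffXY χ' q) := by
  have hpq := T.add_mem hp hq
  have key : ∀ ψ : preim T →* ℝˣ, coeffXY ψ p * coeffXY ψ q =
      (ψ (⟨unitXY p, unitXY_mem_preim hp⟩ * ⟨unitXY q, unitXY_mem_preim hq⟩) : ℝ) := fun ψ => by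
    rw [map_mul, Units.val_mul, coeffXY_of_mem ψ hp, coeffXY_of_mem ψ hq]
  rw [mul_mul_mul_comm, key, key]
  rcases unitXY_mul p q with h | h
  · have h' : (⟨unitXY p, unitXY_mem_preim hp⟩ * ⟨unitXY q, unitXY_mem_preim hq⟩ : preim T) =
        ⟨unitXY (p + q), unitXY_mem_preim hpq⟩ := Subtype.ext h
    rw [h', ← coeffXY_of_mem χ hpq, ← coeffXY_of_mem χ' hpq]
  · have h' : (⟨unitXY p, unitXY_mem_preim hp⟩ * ⟨unitXY q, unitXY_mem_preim hq⟩ : preim T) =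
        ⟨-unitXY (p + q), neg_unitXY_mem_preim hpq⟩ := Subtype.ext h
    rw [h', map_neg_unitXY χ hχ hpq, map_neg_unitXY χ' hχ' hpq, neg_mul_neg]

/-- Distinct characters of the same preimage have orthogonal coefficients. -/
lemma sum_coeffXY_mul_coeffXY (χ χ' : preim T →* ℝˣ)
    (hval : ∀ s : preim T, (χ s : ℝ) = 1 ∨ (χ s : ℝ) = -1)
    (hval' : ∀ s : preim T, (χ' s : ℝ) = 1 ∨ (χ' s : ℝ) = -1)
    (hχ : ∀ m : preim T, ((m : (Matrix (U i) (U i) ℝ)ˣ) : Matrix (U i) (U i) ℝ) = -1 → χ m = -1)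
    (hχ' : ∀ m : preim T, ((m : (Matrix (U i) (U i) ℝ)ˣ) : Matrix (U i) (U i) ℝ) = -1 → χ' m = -1)
    (hne : coeffXY χ ≠ coeffXY χ') :
    ∑ p, coeffXY χ p * coeffXY χ' p = 0 := by
  obtain ⟨q, hq⟩ := Function.ne_iff.1 hne
  have hqT : q ∈ T := by
    by_contra h
    exact hq (by rw [coeffXY_of_notMem χ h, coeffXY_of_notMem χ' h])
  have hd : coeffXY χ q * coeffXY χ' q = -1 := by
    rw [coeffXY_of_mem χ hqT, coeffXY_of_mem χ' hqT] at hq ⊢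
    rcases hval ⟨unitXY q, unitXY_mem_preim hqT⟩ with h | h <;>
      rcases hval' ⟨unitXY q, unitXY_mem_preim hqT⟩ with h' | h' <;> simp_all
  have hshift : ∀ p, coeffXY χ (p + q) * coeffXY χ' (p + q) = -(coeffXY χ p * coeffXY χ' p) := by
    intro p
    by_cases hp : p ∈ T
    · rw [coeffXY_mul_coeffXY_add χ χ' hχ hχ' hp hqT, hd, mul_neg_one]
    · rw [coeffXY_of_notMem χ hp, coeffXY_of_notMem χ fun h => hp ((T.add_mem_iff_left hqT).1 h)]
      simp
  have h := Equiv.sum_comp (Equiv.addRight q) fun p => coeffXY χ p * coeffXY χ' p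
  simp only [Equiv.coe_addRight, hshift, Finset.sum_neg_distrib] at h
  linarith

lemma natCard_submodule_zmod_two (T : Submodule (ZMod 2) (U i × U i)) :
    (Nat.card T : ℝ) = 2 ^ Module.finrank (ZMod 2) T := by
  rw [Module.natCard_eq_pow_finrank (K := ZMod 2)]
  simp

open Classical in
lemma sum_indicator_submodule (T : Submodule (ZMod 2) (U i × U i)) :
    ∑ p, (if p ∈ T then (1 : ℝ) else 0) = 2 ^ Module.finrank (ZMod 2) T := by
  rw [← natCard_submodule_zmod_two, Finset.sum_boole, Nat.card_eq_fintype_card,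
    Fintype.card_subtype]

/-- Characters of preimages of two subspaces have coefficient vectors at distance controlled by
the intersection. -/
lemma sum_coeffXY_sub_sq_ge {T T' : Submodule (ZMod 2) (U i × U i)}
    (χ : preim T →* ℝˣ) (χ' : preim T' →* ℝˣ)
    (hval : ∀ s : preim T, (χ s : ℝ) = 1 ∨ (χ s : ℝ) = -1)
    (hval' : ∀ s : preim T', (χ' s : ℝ) = 1 ∨ (χ' s : ℝ) = -1) :
    (2 : ℝ) ^ Module.finrank (ZMod 2) T + 2 ^ Module.finrank (ZMod 2) T' -
      2 * 2 ^ Module.finrank (ZMod 2) (T ⊓ T' : Submodule (ZMod 2) (U i × U i)) ≤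
      ∑ p, (coeffXY χ p - coeffXY χ' p) ^ 2 := by
  classical
  simp only [← sum_indicator_submodule, Finset.mul_sum, ← Finset.sum_add_distrib,
    ← Finset.sum_sub_distrib]
  refine Finset.sum_le_sum fun p _ => ?_
  by_cases hp : p ∈ T <;> by_cases hp' : p ∈ T'
  · simp only [hp, hp', Submodule.mem_inf, and_self, if_true]
    nlinarith [sq_nonneg (coeffXY χ p - coeffXY χ' p)]
  · simp [hp, hp', coeffXY_of_notMem χ' hp', coeffXY_sq χ hval hp]
  · simp [hp, hp', coeffXY_of_notMem χ hp, coeffXY_sq χ' hval' hp']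
  · simp [hp, hp', coeffXY_of_notMem χ hp, coeffXY_of_notMem χ' hp']

lemma sum_coeffXY_sq (χ : preim T →* ℝˣ)
    (hval : ∀ s : preim T, (χ s : ℝ) = 1 ∨ (χ s : ℝ) = -1) :
    ∑ p, coeffXY χ p ^ 2 = 2 ^ Module.finrank (ZMod 2) T := by
  classical
  rw [← sum_indicator_submodule]
  refine Finset.sum_congr rfl fun p _ => ?_
  by_cases hp : p ∈ T
  · simp [hp, coeffXY_sq χ hval hp]
  · simp [hp, coeffXY_of_notMem χ hp]

end

/-- given totally singular `(i−k)`-dimensional subspaces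
    `S̄₁, …, S̄_M` with pairwise intersections of dimension at most `ℓ`, any two
    distinct projections `Π, Π'` built from them satisfy
    `½‖Π − Π'‖² ≥ 2^k − 2^{2k+ℓ−i}`. -/
theorem stmt12 (i k ℓ M : ℕ) (hi : 0 < i) (hk : k ≤ i)
    (S : Fin M → Submodule (ZMod 2) (U i × U i))
    (hdim : ∀ r, Module.finrank (ZMod 2) (S r) = i - k)
    (hts : ∀ r, TotSing (S r))
    (hint : ∀ r t, r ≠ t → Module.finrank (ZMod 2) ((S r ⊓ S t : Submodule (ZMod 2) _)) ≤ ℓ)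
    (r t : Fin M)
    (χ : preim (S r) →* ℝˣ) (χ' : preim (S t) →* ℝˣ)
    (hval : ∀ s : preim (S r), (χ s : ℝ) = 1 ∨ (χ s : ℝ) = -1)
    (hval' : ∀ s : preim (S t), (χ' s : ℝ) = 1 ∨ (χ' s : ℝ) = -1)
    (hχ : ∀ m : preim (S r),
      ((m : (Matrix (U i) (U i) ℝ)ˣ) : Matrix (U i) (U i) ℝ) = -1 → χ m = -1)
    (hχ' : ∀ m : preim (S t),
      ((m : (Matrix (U i) (U i) ℝ)ˣ) : Matrix (U i) (U i) ℝ) = -1 → χ' m = -1)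
    (hne : PiMat (preim (S r)) χ ≠ PiMat (preim (S t)) χ') :
    (1 / 2 : ℝ) * frobSq (PiMat (preim (S r)) χ - PiMat (preim (S t)) χ') ≥
      (2 : ℝ) ^ (k : ℤ) - (2 : ℝ) ^ (2 * (k : ℤ) + (ℓ : ℤ) - (i : ℤ)) := by
  have hformula : (1 / 2 : ℝ) * frobSq (PiMat (preim (S r)) χ - PiMat (preim (S t)) χ') =
      1 / 2 * ((((2 : ℝ) ^ (i - k))⁻¹) ^ 2 *
        (2 ^ i * ∑ p, (coeffXY χ p - coeffXY χ' p) ^ 2)) := by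
    rw [PiMat_preim χ hχ, PiMat_preim χ' hχ', natCard_submodule_zmod_two,
      natCard_submodule_zmod_two, hdim, hdim, ← smul_sub, frobSq_smul, ← Finset.sum_sub_distrib]
    simp only [← sub_smul]
    rw [frobSq_sum_smul_XY]
  have hmain : 2 * ((2 : ℝ) ^ (i - k) - 2 ^ ℓ) ≤ ∑ p, (coeffXY χ p - coeffXY χ' p) ^ 2 := by
    by_cases hrt : r = t
    · subst hrt
      have hne' : coeffXY χ ≠ coeffXY χ' := fun h => hne (by
        rw [PiMat_preim χ hχ, PiMat_preim χ' hχ', h])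
      have h0 := sum_coeffXY_mul_coeffXY χ χ' hval hval' hχ hχ' hne'
      have h1 := sum_coeffXY_sq χ hval
      have h2 := sum_coeffXY_sq χ' hval'
      have h3 : ∑ p, (coeffXY χ p - coeffXY χ' p) ^ 2 = ∑ p, coeffXY χ p ^ 2 +
          ∑ p, coeffXY χ' p ^ 2 - 2 * ∑ p, coeffXY χ p * coeffXY χ' p := by
        rw [Finset.mul_sum, ← Finset.sum_add_distrib, ← Finset.sum_sub_distrib]
        exact Finset.sum_congr rfl fun p _ => by ring
      rw [h3, h0, h1, h2, hdim]
      have : (0 : ℝ) < 2 ^ ℓ := by positivity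
      linarith
    · have h := sum_coeffXY_sub_sq_ge χ χ' hval hval'
      have hl : (2 : ℝ) ^ Module.finrank (ZMod 2) (S r ⊓ S t : Submodule (ZMod 2) (U i × U i)) ≤
          2 ^ ℓ := pow_le_pow_right₀ one_le_two (hint r t hrt)
      rw [hdim, hdim] at h
      linarith
  obtain ⟨n, rfl⟩ := Nat.exists_eq_add_of_le hk
  rw [Nat.add_sub_cancel_left] at hformula hmain
  have hz : (2 : ℝ) ^ (2 * (k : ℤ) + (ℓ : ℤ) - ((k + n : ℕ) : ℤ)) = 2 ^ k * 2 ^ ℓ / 2 ^ n := by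
    rw [show 2 * (k : ℤ) + (ℓ : ℤ) - ((k + n : ℕ) : ℤ) = ((k + ℓ : ℕ) : ℤ) - (n : ℤ) by
      push_cast; ring, zpow_sub₀ two_ne_zero, zpow_natCast, zpow_natCast, pow_add]
  rw [hformula, hz, zpow_natCast, ge_iff_le]
  calc (2 : ℝ) ^ k - 2 ^ k * 2 ^ ℓ / 2 ^ n
      = 1 / 2 * (((2 : ℝ) ^ n)⁻¹ ^ 2 * (2 ^ (k + n) * (2 * (2 ^ n - 2 ^ ℓ)))) := by
        rw [pow_add]
        field_simp
    _ ≤ _ := by gcongr
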